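/- Fix n ≥ 1, ζ ∈ (0,1), and constants M ≥ 0 and r ≥ 0. Let (A(k))_{k≥0} be a sequence of n×n row-stochastic matrices, (b(k))_{k≥0} real numbers with |b(k)| ≤ 2 for all k, and (C(k))_{k≥0} vectors in ℝⁿ with ‖C(k)‖₂ ≤ r for all k. Let η(k) := 1/(k+1). Let (w(k))_{k≥0} be vectors in ℝⁿ satisfying the recursion w(k+1) = A(k)·w(k) + η(k)·b(k)·w(k) + η(k)·C(k) and the uniform bound ‖w(k)‖₂ ≤ M for all k. Assume that for all l ≤ t, ‖A(t)·A(t−1)·…·A(l) − 𝟏·p(l,t)ᵀ‖_F ≤ n·ζ^{t−l}, where p(l,t)ᵀ := (1/n)·𝟏ᵀ·(A(t)·…·A(l)) is the row vector of column means of the product. Then the consensus error converges to zero: lim_{k→∞} ‖w(k) − w̄(k)·𝟏‖₂ = 0, where w̄(k) := (1/n)Σ_{i=1}^{n} w_i(k). -/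

import Mathlib

/-- A matrix is row-stochastic if all entries are nonnegative and each row sums to 1. -/
def IsRowStochastic {n : ℕ} (X : Matrix (Fin n) (Fin n) ℝ) : Prop :=
  (∀ i j, 0 ≤ X i j) ∧ ∀ i, ∑ j, X i j = 1

/-- The descending product `A(t)·A(t−1)·…·A(l)`. -/
def descProd {n : ℕ} (A : ℕ → Matrix (Fin n) (Fin n) ℝ) (l t : ℕ) :
    Matrix (Fin n) (Fin n) ℝ :=
  (List.ofFn (fun i : Fin (t + 1 - l) => A (t - (i : ℕ)))).prod

/-- Frobenius norm: square root of the sum of squares of all entries. -/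
noncomputable def frobNorm {n : ℕ} (X : Matrix (Fin n) (Fin n) ℝ) : ℝ :=
  Real.sqrt (∑ i, ∑ j, (X i j) ^ 2)

/-- Euclidean norm of a vector in ℝⁿ. -/
noncomputable def euclNorm {n : ℕ} (v : Fin n → ℝ) : ℝ :=
  Real.sqrt (∑ i, (v i) ^ 2)

open Filter in
/-- A sequence bounded by a vanishing function of a lag plus, for each fixed lag, a null sequence
tends to zero. -/
theorem tendsto_zero_of_abs_le_lag {f a : ℕ → ℝ} {B : ℕ → ℝ} (ha : Tendsto a atTop (nhds 0))
    (h : ∀ m s, |f (s + m + 1)| ≤ a m + B m / ((s : ℝ) + 1)) : Tendsto f atTop (nhds 0) := by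
  rw [Metric.tendsto_atTop]
  intro ε hε
  obtain ⟨m, hm⟩ := (ha.eventually_lt_const (half_pos hε)).exists
  have hB : Tendsto (fun s : ℕ => B m / ((s : ℝ) + 1)) atTop (nhds 0) := by
    simpa [div_eq_mul_inv] using (tendsto_one_div_add_atTop_nhds_zero_nat (𝕜 := ℝ)).const_mul (B m)
  obtain ⟨N, hN⟩ := eventually_atTop.1 (hB.eventually_lt_const (half_pos hε))
  refine ⟨N + m + 1, fun k hk => ?_⟩
  obtain ⟨s, rfl⟩ : ∃ s, k = s + m + 1 := ⟨k - m - 1, by omega⟩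
  have hs := hN s (by omega)
  rw [Real.dist_eq, sub_zero]
  linarith [h m s]

theorem descProd_self {n : ℕ} (A : ℕ → Matrix (Fin n) (Fin n) ℝ) (l : ℕ) :
    descProd A l l = A l := by
  have h : l + 1 - l = 0 + 1 := by omega
  rw [descProd, List.ofFn_congr h]
  simp

theorem descProd_succ {n : ℕ} (A : ℕ → Matrix (Fin n) (Fin n) ℝ) (l m : ℕ) :
    descProd A l (l + m + 1) = A (l + m + 1) * descProd A l (l + m) := by
  have h : l + m + 1 + 1 - l = (m + 1) + 1 := by omega
  have h' : l + m + 1 - l = m + 1 := by omega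
  rw [descProd, descProd, List.ofFn_congr h, List.ofFn_congr h', List.ofFn_succ, List.prod_cons]
  simp [Nat.add_sub_add_right]

theorem abs_le_euclNorm {n : ℕ} (v : Fin n → ℝ) (i : Fin n) : |v i| ≤ euclNorm v :=
  Real.abs_le_sqrt (Finset.single_le_sum (f := fun i => v i ^ 2) (fun _ _ => sq_nonneg _)
    (Finset.mem_univ i))

theorem euclNorm_row_le_frobNorm {n : ℕ} (X : Matrix (Fin n) (Fin n) ℝ) (i : Fin n) :
    euclNorm (X i) ≤ frobNorm X :=
  Real.sqrt_le_sqrt (Finset.single_le_sum (f := fun i => ∑ j, X i j ^ 2)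
    (fun _ _ => Finset.sum_nonneg fun _ _ => sq_nonneg _) (Finset.mem_univ i))

theorem abs_mulVec_le_frobNorm_mul_euclNorm {n : ℕ} (X : Matrix (Fin n) (Fin n) ℝ)
    (v : Fin n → ℝ) (i : Fin n) : |X.mulVec v i| ≤ frobNorm X * euclNorm v := by
  refine le_trans ?_ (mul_le_mul_of_nonneg_right (euclNorm_row_le_frobNorm X i)
    (Real.sqrt_nonneg _))
  rw [euclNorm, euclNorm, ← Real.sqrt_mul (Finset.sum_nonneg fun _ _ => sq_nonneg _)]
  exact Real.abs_le_sqrt (Finset.sum_mul_sq_le_sq_mul_sq Finset.univ (X i) v)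

theorem IsRowStochastic.abs_mulVec_le {n : ℕ} {X : Matrix (Fin n) (Fin n) ℝ}
    (hX : IsRowStochastic X) {v : Fin n → ℝ} {D : ℝ} (hv : ∀ i, |v i| ≤ D) (i : Fin n) :
    |X.mulVec v i| ≤ D := by
  calc |∑ j, X i j * v j| ≤ ∑ j, |X i j * v j| := Finset.abs_sum_le_sum_abs _ _
    _ ≤ ∑ j, X i j * D := Finset.sum_le_sum fun j _ => by
        rw [abs_mul, abs_of_nonneg (hX.1 i j)]
        exact mul_le_mul_of_nonneg_left (hv j) (hX.1 i j)
    _ = D := by rw [← Finset.sum_mul, hX.2 i, one_mul]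

/-- Over a window of `m + 1` steps, a perturbed linear recursion stays close to the unperturbed
one. -/
theorem abs_sub_descProd_mulVec_le {n : ℕ} {A : ℕ → Matrix (Fin n) (Fin n) ℝ}
    (hA : ∀ k, IsRowStochastic (A k)) {w e : ℕ → Fin n → ℝ}
    (hrec : ∀ k, w (k + 1) = (A k).mulVec (w k) + e k) {K : ℝ} (hK : 0 ≤ K)
    (he : ∀ k i, |e k i| ≤ K / ((k : ℝ) + 1)) (s m : ℕ) (i : Fin n) :
    |(w (s + m + 1) - (descProd A s (s + m)).mulVec (w s)) i| ≤
      ((m : ℝ) + 1) * (K / ((s : ℝ) + 1)) := by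
  induction m generalizing i with
  | zero => simpa [descProd_self, hrec s] using he s i
  | succ m ih =>
    have hstep : w (s + (m + 1) + 1) - (descProd A s (s + (m + 1))).mulVec (w s) =
        (A (s + m + 1)).mulVec (w (s + m + 1) - (descProd A s (s + m)).mulVec (w s)) +
          e (s + m + 1) := by
      rw [← add_assoc, hrec, descProd_succ, Matrix.mulVec_sub, Matrix.mulVec_mulVec]
      abel
    have hmono : K / (((s + m + 1 : ℕ) : ℝ) + 1) ≤ K / ((s : ℝ) + 1) := by
      push_cast
      gcongr
      linarith [(m.cast_nonneg : (0 : ℝ) ≤ m)]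
    rw [hstep, Pi.add_apply]
    push_cast
    linarith [abs_add_le ((A (s + m + 1)).mulVec
      (w (s + m + 1) - (descProd A s (s + m)).mulVec (w s)) i) (e (s + m + 1) i),
      (hA (s + m + 1)).abs_mulVec_le ih i, he (s + m + 1) i]

theorem abs_sub_mean_le {n : ℕ} (hn : 1 ≤ n) {v : Fin n → ℝ} {D : ℝ} (hv : ∀ i, |v i| ≤ D)
    (i : Fin n) : |v i - (1 / (n : ℝ)) * ∑ j, v j| ≤ 2 * D := by
  have hn' : (0 : ℝ) < n := by exact_mod_cast hn
  have hmean : |(1 / (n : ℝ)) * ∑ j, v j| ≤ D := by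
    rw [abs_mul, abs_of_pos (by positivity), one_div, inv_mul_le_iff₀ hn']
    calc |∑ j, v j| ≤ ∑ j, |v j| := Finset.abs_sum_le_sum_abs _ _
      _ ≤ ∑ _j : Fin n, D := Finset.sum_le_sum fun j _ => hv j
      _ = n * D := by simp
  linarith [abs_sub (v i) ((1 / (n : ℝ)) * ∑ j, v j), hv i]

theorem mulVec_sub_mean {n : ℕ} (X : Matrix (Fin n) (Fin n) ℝ) (v : Fin n → ℝ) (i : Fin n) :
    X.mulVec v i - (1 / (n : ℝ)) * ∑ j, X.mulVec v j =
      (Matrix.of fun i j => X i j - (1 / (n : ℝ)) * ∑ i', X i' j).mulVec v i := by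
  simp only [Matrix.mulVec, dotProduct, Matrix.of_apply, sub_mul, Finset.sum_sub_distrib]
  rw [Finset.sum_comm, Finset.mul_sum]
  simp only [Finset.sum_mul, mul_assoc]

theorem stmt15 {n : ℕ} (hn : 1 ≤ n) (ζ : ℝ) (hζ0 : 0 < ζ) (hζ1 : ζ < 1)
    (Mbd r : ℝ) (hMbd : 0 ≤ Mbd) (hr : 0 ≤ r)
    (A : ℕ → Matrix (Fin n) (Fin n) ℝ) (hA : ∀ k, IsRowStochastic (A k))
    (b : ℕ → ℝ) (hb : ∀ k, |b k| ≤ 2)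
    (C : ℕ → (Fin n → ℝ)) (hC : ∀ k, euclNorm (C k) ≤ r)
    (w : ℕ → (Fin n → ℝ))
    (hrec : ∀ k, w (k + 1) = fun i =>
      (A k).mulVec (w k) i + (1 / ((k : ℝ) + 1)) * b k * w k i
        + (1 / ((k : ℝ) + 1)) * C k i)
    (hw : ∀ k, euclNorm (w k) ≤ Mbd)
    (hprod : ∀ l t, l ≤ t →
      frobNorm (Matrix.of fun i j =>
          descProd A l t i j - (1 / (n : ℝ)) * ∑ i', descProd A l t i' j)
        ≤ n * ζ ^ (t - l)) :
    Filter.Tendsto (fun k => euclNorm (fun i => w k i - (1 / (n : ℝ)) * ∑ j, w k j))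
      Filter.atTop (nhds 0) := by
  have hcoord : ∀ i, Filter.Tendsto (fun k => w k i - (1 / (n : ℝ)) * ∑ j, w k j)
      Filter.atTop (nhds 0) := by
    intro i
    have ha : Filter.Tendsto (fun m : ℕ => n * ζ ^ m * Mbd) Filter.atTop (nhds 0) := by
      simpa using ((tendsto_pow_atTop_nhds_zero_of_lt_one hζ0.le hζ1).const_mul
        (n : ℝ)).mul_const Mbd
    refine tendsto_zero_of_abs_le_lag (B := fun m => 2 * (((m : ℝ) + 1) * (2 * Mbd + r))) ha
      fun m s => ?_
    set e : ℕ → Fin n → ℝ := fun k i =>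
      (1 / ((k : ℝ) + 1)) * b k * w k i + (1 / ((k : ℝ) + 1)) * C k i with he_def
    have he : ∀ k i, |e k i| ≤ (2 * Mbd + r) / ((k : ℝ) + 1) := by
      intro k i
      have hk : (0 : ℝ) < (k : ℝ) + 1 := by positivity
      have hsum : |b k * w k i + C k i| ≤ 2 * Mbd + r := by
        refine (abs_add_le _ _).trans (add_le_add ?_ ((abs_le_euclNorm _ i).trans (hC k)))
        rw [abs_mul]
        exact mul_le_mul (hb k) ((abs_le_euclNorm _ i).trans (hw k)) (abs_nonneg _) zero_le_two
      have : e k i = (b k * w k i + C k i) / ((k : ℝ) + 1) := by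
        simp only [he_def]
        ring
      rw [this, abs_div, abs_of_pos hk]
      gcongr
    have hrec' : ∀ k, w (k + 1) = (A k).mulVec (w k) + e k := by
      intro k
      rw [hrec k]
      ext i
      simp only [he_def, Pi.add_apply]
      ring
    have hdev := abs_sub_mean_le hn
      (abs_sub_descProd_mulVec_le hA hrec' (by positivity) he s m) i
    have hmix : |(descProd A s (s + m)).mulVec (w s) i -
        (1 / (n : ℝ)) * ∑ j, (descProd A s (s + m)).mulVec (w s) j| ≤ n * ζ ^ m * Mbd := by
      rw [mulVec_sub_mean]
      refine (abs_mulVec_le_frobNorm_mul_euclNorm _ _ i).trans ?_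
      have := hprod s (s + m) (Nat.le_add_right s m)
      rw [Nat.add_sub_cancel_left] at this
      exact mul_le_mul this (hw s) (Real.sqrt_nonneg _) (by positivity)
    simp only [Pi.sub_apply, Finset.sum_sub_distrib, mul_sub] at hdev
    calc |w (s + m + 1) i - (1 / (n : ℝ)) * ∑ j, w (s + m + 1) j|
        = |((descProd A s (s + m)).mulVec (w s) i -
              (1 / (n : ℝ)) * ∑ j, (descProd A s (s + m)).mulVec (w s) j) +
            (w (s + m + 1) i - (descProd A s (s + m)).mulVec (w s) i -
              ((1 / (n : ℝ)) * ∑ j, w (s + m + 1) j -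
                (1 / (n : ℝ)) * ∑ j, (descProd A s (s + m)).mulVec (w s) j))| := by
          congr 1
          ring
      _ ≤ n * ζ ^ m * Mbd + 2 * (((m : ℝ) + 1) * ((2 * Mbd + r) / ((s : ℝ) + 1))) :=
          (abs_add_le _ _).trans (add_le_add hmix hdev)
      _ = _ := by ring
  simpa [euclNorm] using
    (tendsto_finsetSum Finset.univ fun i _ => (hcoord i).pow 2).sqrt
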